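/- arXiv:1812.04883 — 2 statements merged into one kernel-verified Lean document; each statement's English description precedes it below -/
import Mathlib

section
/- Let r > 0, let Ω = {x ∈ ℝⁿ : |x| ≤ r}, let U ⊆ ℝⁿ be an open connected set containing Ω, and let f : U → ℝ be a real-analytic function, not identically zero, for which there exists a nonzero polynomial P ∈ ℝ[x₁,…,xₙ,y] with P(x, f(x)) = 0 for all x ∈ U. Then there exists ε > 0 such that for every x ∈ ℝⁿ with |x| = r and 0 < |f(x)| < ε, the vectors x and ∇f(x) are linearly independent in ℝⁿ. -/
open Set Filter Topology

open scoped IntermediateField.algebraAdjoinAdjoin in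
theorem IsTranscendenceBasis.formallyEtale_adjoin {F K ι : Type*} [Field F] [Field K] [Algebra F K]
    [CharZero F] {v : ι → K} (hv : IsTranscendenceBasis F v) :
    Algebra.FormallyEtale (Algebra.adjoin F (Set.range v)) K := by
  have : CharZero K := charZero_of_injective_algebraMap (algebraMap F K).injective
  have : Algebra.IsAlgebraic (IntermediateField.adjoin F (Set.range v)) K := hv.isAlgebraic_field
  have : Algebra.FormallyEtale (IntermediateField.adjoin F (Set.range v)) K :=
    Algebra.FormallyEtale.of_isSeparable _ K
  have : Algebra.FormallyEtale (Algebra.adjoin F (Set.range v))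
      (IntermediateField.adjoin F (Set.range v)) :=
    .of_isLocalization (nonZeroDivisors _)
  exact .comp _ (IntermediateField.adjoin F (Set.range v)) _

/-- Over a field of characteristic zero, a derivation that does not kill a given transcendental
element. -/
theorem Transcendental.exists_derivation_eq_one {F K : Type*} [Field F] [Field K] [Algebra F K]
    [CharZero F] {c : K} (hc : Transcendental F c) :
    ∃ D : Derivation F K K, D c = 1 := by
  obtain ⟨s, hcs, hs⟩ := exists_isTranscendenceBasis_superset
    (R := F) (A := K) (s := {c}) (by
      exact (algebraicIndependent_unique_type_iff (ι := ({c} : Set K))).2 hc)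
  let A := Algebra.adjoin F (Set.range ((↑) : s → K))
  have : Algebra.FormallyEtale A K := hs.formallyEtale_adjoin
  let e : MvPolynomial s F ≃ₐ[F] A := hs.1.aevalEquiv
  let i : s := ⟨c, hcs rfl⟩
  let d : Derivation F A K := Derivation.mk'
    ((A.val.toLinearMap ∘ₗ e.toLinearMap ∘ₗ (MvPolynomial.pderiv i).toLinearMap) ∘ₗ
      e.symm.toLinearMap) (fun a b => by
        simp [Algebra.smul_def])
  refine ⟨((d.liftKaehlerDifferential.liftBaseChange K) ∘ₗ
    (KaehlerDifferential.tensorKaehlerEquivOfFormallyEtale F A K).symm.toLinearMap).compDer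
      (KaehlerDifferential.D F K), ?_⟩
  have hci : algebraMap A K (e (MvPolynomial.X i)) = c := by
    rw [hs.1.algebraMap_aevalEquiv, MvPolynomial.aeval_X]
  have hD := KaehlerDifferential.tensorKaehlerEquivOfFormallyEtale_symm_D_algebraMap F A K
    (e (MvPolynomial.X i))
  rw [hci] at hD
  simp [hD, d]

/-- The derivation of `K⟦X⟧` applying a derivation of `K` to all coefficients. -/
noncomputable def Derivation.mapPowerSeries {R K : Type*} [CommRing R] [CommRing K] [Algebra R K]
    (D : Derivation R K K) : Derivation R (PowerSeries K) (PowerSeries K) :=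
  Derivation.mk'
    { toFun := fun p => PowerSeries.mk fun m => D (PowerSeries.coeff m p)
      map_add' := fun p q => by ext; simp
      map_smul' := fun a p => by ext; simp }
    fun p q => by
      ext m
      simp only [LinearMap.coe_mk, AddHom.coe_mk, PowerSeries.coeff_mk, PowerSeries.coeff_mul,
        smul_eq_mul, map_add, map_sum, Derivation.leibniz, Finset.sum_add_distrib]
      congr 1
      rw [← Finset.Nat.sum_antidiagonal_swap]
      rfl

theorem Derivation.coeff_mapPowerSeries {R K : Type*} [CommRing R] [CommRing K] [Algebra R K]
    (D : Derivation R K K) (p : PowerSeries K) (m : ℕ) :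
    PowerSeries.coeff m (D.mapPowerSeries p) = D (PowerSeries.coeff m p) := by
  simp [Derivation.mapPowerSeries]

section Taylor

variable {E : Type*} [NormedAddCommGroup E] [NormedSpace ℝ E]

/-- The derivative of `g` in the direction `w`. -/
noncomputable def dirDeriv (w : E) (g : E → ℝ) : E → ℝ := fun y => fderiv ℝ g y w

theorem AnalyticOnNhd.dirDeriv {U : Set E} {g : E → ℝ} (hg : AnalyticOnNhd ℝ g U) (w : E) :
    AnalyticOnNhd ℝ (dirDeriv w g) U := fun y hy =>
  ((ContinuousLinearMap.apply ℝ ℝ w).analyticAt _).comp (hg.fderiv y hy)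

theorem AnalyticOnNhd.iterate_dirDeriv {U : Set E} {g : E → ℝ} (hg : AnalyticOnNhd ℝ g U) (w : E)
    (m : ℕ) : AnalyticOnNhd ℝ ((_root_.dirDeriv w)^[m] g) U := by
  induction m with
  | zero => exact hg
  | succ m ih => rw [Function.iterate_succ_apply']; exact ih.dirDeriv w

theorem dirDeriv_const (w : E) (a : ℝ) : dirDeriv w (fun _ => a) = fun _ => 0 := by
  ext y; simp [dirDeriv]

theorem dirDeriv_congr {U : Set E} (hU : IsOpen U) (w : E) {g h : E → ℝ} (hgh : EqOn g h U) :
    EqOn (dirDeriv w g) (dirDeriv w h) U := fun y hy => by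
  have : g =ᶠ[𝓝 y] h := hgh.eventuallyEq_of_mem (hU.mem_nhds hy)
  simp [dirDeriv, this.fderiv_eq]

theorem iterate_dirDeriv_congr {U : Set E} (hU : IsOpen U) (w : E) {g h : E → ℝ}
    (hgh : EqOn g h U) (m : ℕ) : EqOn ((dirDeriv w)^[m] g) ((dirDeriv w)^[m] h) U := by
  induction m with
  | zero => exact hgh
  | succ m ih => simp only [Function.iterate_succ_apply']; exact dirDeriv_congr hU w ih

theorem dirDeriv_add {U : Set E} (w : E) {g h : E → ℝ} (hg : AnalyticOnNhd ℝ g U)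
    (hh : AnalyticOnNhd ℝ h U) : EqOn (dirDeriv w (g + h)) (dirDeriv w g + dirDeriv w h) U :=
  fun y hy => by
    simp [dirDeriv, fderiv_add (hg y hy).differentiableAt (hh y hy).differentiableAt]

theorem dirDeriv_mul {U : Set E} (w : E) {g h : E → ℝ} (hg : AnalyticOnNhd ℝ g U)
    (hh : AnalyticOnNhd ℝ h U) :
    EqOn (dirDeriv w (g * h)) (dirDeriv w g * h + g * dirDeriv w h) U := fun y hy => by
  simp [dirDeriv, fderiv_mul (hg y hy).differentiableAt (hh y hy).differentiableAt]
  ring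

variable {K : Type*} [Field K] [Algebra ℝ K]

/-- The formal Taylor series in the direction `w`, at the generalized point `ev`. -/
noncomputable def taylorSeries (ev : (E → ℝ) →ₐ[ℝ] K) (w : E) (g : E → ℝ) : PowerSeries K :=
  PowerSeries.mk fun m => (m.factorial : ℝ)⁻¹ • ev ((dirDeriv w)^[m] g)

variable {U : Set E} {ev : (E → ℝ) →ₐ[ℝ] K}

theorem taylorSeries_congr (hU : IsOpen U) (hev : ∀ g h, EqOn g h U → ev g = ev h) (w : E)
    {g h : E → ℝ} (hgh : EqOn g h U) : taylorSeries ev w g = taylorSeries ev w h := by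
  ext m
  simp [taylorSeries, hev _ _ (iterate_dirDeriv_congr hU w hgh m)]

theorem derivative_taylorSeries (w : E) (g : E → ℝ) :
    PowerSeries.derivative K (taylorSeries ev w g) = taylorSeries ev w (dirDeriv w g) := by
  ext m
  rw [PowerSeries.coeff_derivative]
  simp only [taylorSeries, PowerSeries.coeff_mk, Function.iterate_succ_apply, Algebra.smul_def]
  have : (m + 1 : K) = algebraMap ℝ K (m + 1) := by simp
  rw [this, mul_right_comm, ← map_mul]
  congr 2
  rw [Nat.factorial_succ]
  push_cast
  field_simp

theorem constantCoeff_taylorSeries (w : E) (g : E → ℝ) :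
    PowerSeries.constantCoeff (taylorSeries ev w g) = ev g := by
  rw [← PowerSeries.coeff_zero_eq_constantCoeff_apply]
  simp [taylorSeries]

theorem taylorSeries_const (w : E) (a : ℝ) :
    taylorSeries ev w (fun _ => a) = PowerSeries.C (algebraMap ℝ K a) := by
  have : CharZero K := charZero_of_injective_algebraMap (algebraMap ℝ K).injective
  have h0 : taylorSeries ev w (fun _ => (0 : ℝ)) = 0 := by
    ext k
    rw [taylorSeries, PowerSeries.coeff_mk, Function.iterate_fixed (dirDeriv_const w 0) k]
    exact (congrArg _ (map_zero ev)).trans (smul_zero _)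
  apply PowerSeries.derivative.ext
  · rw [derivative_taylorSeries, dirDeriv_const, PowerSeries.derivative_C]
    exact h0
  · rw [constantCoeff_taylorSeries, PowerSeries.constantCoeff_C]
    exact ev.commutes a

theorem PowerSeries.coeff_succ_eq_of_coeff_derivative_eq {K : Type*} [Field K] [CharZero K]
    {p q : PowerSeries K} {m : ℕ}
    (h : PowerSeries.coeff m (PowerSeries.derivative K p) =
      PowerSeries.coeff m (PowerSeries.derivative K q)) :
    PowerSeries.coeff (m + 1) p = PowerSeries.coeff (m + 1) q := by
  simp only [PowerSeries.coeff_derivative] at h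
  exact mul_right_cancel₀ (by exact_mod_cast Nat.succ_ne_zero m) h

theorem taylorSeries_add (hU : IsOpen U) (hev : ∀ g h, EqOn g h U → ev g = ev h) (w : E)
    {g h : E → ℝ} (hg : AnalyticOnNhd ℝ g U) (hh : AnalyticOnNhd ℝ h U) :
    taylorSeries ev w (g + h) = taylorSeries ev w g + taylorSeries ev w h := by
  have : CharZero K := charZero_of_injective_algebraMap (algebraMap ℝ K).injective
  ext m
  induction m generalizing g h with
  | zero => simp [constantCoeff_taylorSeries]
  | succ m ih =>
    apply PowerSeries.coeff_succ_eq_of_coeff_derivative_eq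
    rw [map_add, derivative_taylorSeries, derivative_taylorSeries, derivative_taylorSeries,
      taylorSeries_congr hU hev w (dirDeriv_add w hg hh), ih (hg.dirDeriv w) (hh.dirDeriv w)]

theorem taylorSeries_mul (hU : IsOpen U) (hev : ∀ g h, EqOn g h U → ev g = ev h) (w : E)
    {g h : E → ℝ} (hg : AnalyticOnNhd ℝ g U) (hh : AnalyticOnNhd ℝ h U) :
    taylorSeries ev w (g * h) = taylorSeries ev w g * taylorSeries ev w h := by
  have : CharZero K := charZero_of_injective_algebraMap (algebraMap ℝ K).injective
  ext m
  induction m generalizing g h with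
  | zero => simp [constantCoeff_taylorSeries]
  | succ m ih =>
    apply PowerSeries.coeff_succ_eq_of_coeff_derivative_eq
    rw [Derivation.leibniz, derivative_taylorSeries, derivative_taylorSeries,
      derivative_taylorSeries, taylorSeries_congr hU hev w (dirDeriv_mul w hg hh),
      taylorSeries_add hU hev w (g := dirDeriv w g * h) (h := g * dirDeriv w h)
        ((hg.dirDeriv w).mul hh) (hg.mul (hh.dirDeriv w)), map_add,
      ih (hg.dirDeriv w) hh, ih hg (hh.dirDeriv w), ← map_add]
    congr 1
    simp only [smul_eq_mul]
    ring

/-- The defect of the chain rule for a derivation of `K`, as a power series. -/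
noncomputable def chainDefect {ι : Type*} [Fintype ι] (ev : (E → ℝ) →ₐ[ℝ] K) (w : E)
    (D : Derivation ℝ K K) (v : ι → K) (e : ι → E) (g : E → ℝ) : PowerSeries K :=
  D.mapPowerSeries (taylorSeries ev w g) -
    ∑ i, PowerSeries.C (v i) * taylorSeries ev w (dirDeriv (e i) g)

variable {ι : Type*} [Fintype ι] {D : Derivation ℝ K K} {v : ι → K} {e : ι → E} {w : E}

theorem chainDefect_const (a : ℝ) : chainDefect ev w D v e (fun _ => a) = 0 := by
  have h : D.mapPowerSeries (PowerSeries.C (algebraMap ℝ K a)) = 0 := by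
    ext m
    rw [Derivation.coeff_mapPowerSeries, PowerSeries.coeff_C]
    split_ifs <;> simp
  simp [chainDefect, dirDeriv_const, taylorSeries_const, h]

theorem chainDefect_congr (hU : IsOpen U) (hev : ∀ g h, EqOn g h U → ev g = ev h)
    {g h : E → ℝ} (hgh : EqOn g h U) : chainDefect ev w D v e g = chainDefect ev w D v e h := by
  simp only [chainDefect, taylorSeries_congr hU hev w hgh,
    fun i => taylorSeries_congr hU hev w (dirDeriv_congr hU (e i) hgh)]

theorem chainDefect_add (hU : IsOpen U) (hev : ∀ g h, EqOn g h U → ev g = ev h)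
    {g h : E → ℝ} (hg : AnalyticOnNhd ℝ g U) (hh : AnalyticOnNhd ℝ h U) :
    chainDefect ev w D v e (g + h) = chainDefect ev w D v e g + chainDefect ev w D v e h := by
  have : ∀ i, taylorSeries ev w (dirDeriv (e i) (g + h)) =
      taylorSeries ev w (dirDeriv (e i) g) + taylorSeries ev w (dirDeriv (e i) h) := fun i => by
    rw [taylorSeries_congr hU hev w (dirDeriv_add (e i) hg hh),
      taylorSeries_add hU hev w (hg.dirDeriv _) (hh.dirDeriv _)]
  simp only [chainDefect, this, taylorSeries_add hU hev w hg hh, map_add, mul_add,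
    Finset.sum_add_distrib]
  ring

theorem chainDefect_mul (hU : IsOpen U) (hev : ∀ g h, EqOn g h U → ev g = ev h)
    {g h : E → ℝ} (hg : AnalyticOnNhd ℝ g U) (hh : AnalyticOnNhd ℝ h U) :
    chainDefect ev w D v e (g * h) = taylorSeries ev w g * chainDefect ev w D v e h +
      taylorSeries ev w h * chainDefect ev w D v e g := by
  have : ∀ i, taylorSeries ev w (dirDeriv (e i) (g * h)) =
      taylorSeries ev w (dirDeriv (e i) g) * taylorSeries ev w h +
      taylorSeries ev w g * taylorSeries ev w (dirDeriv (e i) h) := fun i => by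
    rw [taylorSeries_congr hU hev w (dirDeriv_mul (e i) hg hh),
      taylorSeries_add hU hev w (g := dirDeriv (e i) g * h) (h := g * dirDeriv (e i) h)
        ((hg.dirDeriv _).mul hh) (hg.mul (hh.dirDeriv _)),
      taylorSeries_mul hU hev w (hg.dirDeriv _) hh, taylorSeries_mul hU hev w hg (hh.dirDeriv _)]
  simp only [chainDefect, this, taylorSeries_mul hU hev w hg hh, Derivation.leibniz, mul_add,
    Finset.sum_add_distrib, smul_eq_mul, mul_sub, Finset.mul_sum]
  have h1 : ∀ i, PowerSeries.C (v i) * (taylorSeries ev w (dirDeriv (e i) g) *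
      taylorSeries ev w h) = taylorSeries ev w h * (PowerSeries.C (v i) *
      taylorSeries ev w (dirDeriv (e i) g)) := fun i => by ring
  have h2 : ∀ i, PowerSeries.C (v i) * (taylorSeries ev w g *
      taylorSeries ev w (dirDeriv (e i) h)) = taylorSeries ev w g * (PowerSeries.C (v i) *
      taylorSeries ev w (dirDeriv (e i) h)) := fun i => by ring
  simp only [h1, h2]
  ring

theorem chainDefect_mvPolynomial {σ : Type*} [Fintype σ] (hU : IsOpen U)
    (hev : ∀ g h, EqOn g h U → ev g = ev h) {g : E → σ → ℝ}
    (hg : ∀ s, AnalyticOnNhd ℝ (g · s) U) (Q : MvPolynomial σ ℝ) :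
    chainDefect ev w D v e (fun y => MvPolynomial.aeval (g y) Q) =
      ∑ s, taylorSeries ev w (fun y => MvPolynomial.aeval (g y) (MvPolynomial.pderiv s Q)) *
        chainDefect ev w D v e (g · s) := by
  classical
  have ha := fun Q : MvPolynomial σ ℝ => AnalyticOnNhd.aeval_mvPolynomial hg Q
  induction Q using MvPolynomial.induction_on with
  | C a =>
    have : taylorSeries ev w (fun _ => (0 : ℝ)) = 0 := by simp [taylorSeries_const]
    simp [chainDefect_const, this]
  | add p q hp hq =>
    have hadd : ∀ p q : MvPolynomial σ ℝ, (fun y => MvPolynomial.aeval (g y) (p + q)) =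
      (fun y => MvPolynomial.aeval (g y) p) + fun y => MvPolynomial.aeval (g y) q :=
      fun p q => by ext; simp
    simp only [map_add (MvPolynomial.pderiv _), hadd, chainDefect_add hU hev (ha _) (ha _), hp, hq,
      taylorSeries_add hU hev w (ha _) (ha _), add_mul, Finset.sum_add_distrib]
  | mul_X p j hp =>
    have hmul : (fun y => MvPolynomial.aeval (g y) (p * MvPolynomial.X j)) =
      (fun y => MvPolynomial.aeval (g y) p) * fun y => g y j := by ext; simp
    have hm : ∀ s, AnalyticOnNhd ℝ
        ((g · j) * fun y => MvPolynomial.aeval (g y) (MvPolynomial.pderiv s p)) U :=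
      fun s => (hg j).mul (ha _)
    have hder : ∀ s, taylorSeries ev w (fun y => MvPolynomial.aeval (g y)
        (MvPolynomial.pderiv s (p * MvPolynomial.X j))) =
        taylorSeries ev w (g · j) * taylorSeries ev w
          (fun y => MvPolynomial.aeval (g y) (MvPolynomial.pderiv s p)) +
        if s = j then taylorSeries ev w (fun y => MvPolynomial.aeval (g y) p) else 0 := fun s => by
      rw [← taylorSeries_mul hU hev w (hg j) (ha _)]
      split_ifs with h
      · rw [← taylorSeries_add hU hev w (hm s) (ha _)]
        congr 1
        ext y
        subst h
        simp
        ring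
      · rw [add_zero]
        congr 1
        ext y
        simp [MvPolynomial.pderiv_X_of_ne (Ne.symm h)]
    rw [hmul, chainDefect_mul hU hev (ha _) (hg j), hp, Finset.mul_sum]
    simp only [hder, add_mul, ite_mul, zero_mul, Finset.sum_add_distrib, Finset.sum_ite_eq',
      Finset.mem_univ, if_true, mul_assoc]
    rw [add_comm]

/-- A continuous linear function satisfies the chain rule. -/
theorem chainDefect_clm (L : E →L[ℝ] ℝ) (hL : D (ev L) = ∑ i, L (e i) • v i) :
    chainDefect ev w D v e L = 0 := by
  have hd : ∀ u, dirDeriv u L = fun _ => L u := fun u => by ext; simp [dirDeriv]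
  have hT : D.mapPowerSeries (taylorSeries ev w L) = PowerSeries.C (D (ev L)) := by
    ext m
    rw [Derivation.coeff_mapPowerSeries]
    cases m with
    | zero => simp [constantCoeff_taylorSeries]
    | succ m =>
      have h := congrArg (PowerSeries.coeff m) (derivative_taylorSeries (ev := ev) w L)
      rw [hd, taylorSeries_const, PowerSeries.coeff_derivative] at h
      have hD := congrArg D h
      have : (m + 1 : K) = algebraMap ℝ K (m + 1) := by simp
      rw [PowerSeries.coeff_C, this, mul_comm, ← Algebra.smul_def, Derivation.map_smul] at hD
      have h0 : D (if m = 0 then algebraMap ℝ K (L w) else 0) = 0 := by split_ifs <;> simp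
      rw [h0, smul_eq_zero] at hD
      rw [hD.resolve_left (by positivity), PowerSeries.coeff_C, if_neg (by simp)]
  simp only [chainDefect, hT, hL, hd, taylorSeries_const, map_sum, ← map_mul, Algebra.smul_def,
    mul_comm, sub_self]

theorem constantCoeff_chainDefect (g : E → ℝ) :
    PowerSeries.constantCoeff (chainDefect ev w D v e g) =
      D (ev g) - ∑ i, v i * ev (dirDeriv (e i) g) := by
  rw [chainDefect, map_sub, map_sum, ← PowerSeries.coeff_zero_eq_constantCoeff_apply,
    Derivation.coeff_mapPowerSeries]
  simp [constantCoeff_taylorSeries]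

end Taylor

theorem MvPolynomial.totalDegree_pderiv_lt {σ R : Type*} [CommSemiring R] {P : MvPolynomial σ R}
    {i : σ} (h : MvPolynomial.pderiv i P ≠ 0) :
    (MvPolynomial.pderiv i P).totalDegree < P.totalDegree := by
  obtain ⟨m, hm, hmax⟩ : ∃ m ∈ (pderiv i P).support, (pderiv i P).totalDegree = m.degree :=
    Finset.exists_mem_eq_sup _ (MvPolynomial.support_nonempty.2 h) Finsupp.degree
  rw [hmax]
  have hmem : m + Finsupp.single i 1 ∈ P.support := by
    rw [MvPolynomial.mem_support_iff] at hm ⊢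
    rw [MvPolynomial.coeff_pderiv] at hm
    exact left_ne_zero_of_mul hm
  have := MvPolynomial.le_totalDegree hmem
  change (m + Finsupp.single i 1).degree ≤ _ at this
  rw [map_add, Finsupp.degree_single] at this
  omega

theorem MvPolynomial.notMem_vars_of_pderiv_eq_zero {σ R : Type*} [CommRing R] [IsDomain R]
    [CharZero R] {P : MvPolynomial σ R} {i : σ} (h : MvPolynomial.pderiv i P = 0) :
    i ∉ P.vars := by
  classical
  intro hi
  obtain ⟨m, hm, him⟩ := (MvPolynomial.mem_vars_iff_mem_support i).1 hi
  have hle : Finsupp.single i 1 ≤ m := by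
    rw [Finsupp.single_le_iff]
    exact Nat.one_le_iff_ne_zero.2 (Finsupp.mem_support_iff.1 him)
  have hc := congrArg (MvPolynomial.coeff (m - Finsupp.single i 1)) h
  rw [MvPolynomial.coeff_pderiv, tsub_add_cancel_of_le hle, MvPolynomial.coeff_zero,
    mul_eq_zero] at hc
  rcases hc with hc | hc
  · exact (MvPolynomial.mem_support_iff.1 hm) hc
  · exact Nat.cast_add_one_ne_zero _ hc

/-- A function annihilated by a nonzero polynomial on a nonempty open set is annihilated by one
whose derivative in the last variable does not annihilate it. -/
theorem exists_annihilator_pderiv_ne_zero {n : ℕ} {U : Set (EuclideanSpace ℝ (Fin n))}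
    (hU : IsOpen U) (hne : U.Nonempty) {f : EuclideanSpace ℝ (Fin n) → ℝ}
    {P : MvPolynomial (Fin (n + 1)) ℝ} (hP : P ≠ 0)
    (hPf : ∀ x ∈ U, MvPolynomial.eval (Fin.snoc (fun i => x i) (f x)) P = 0) :
    ∃ Q : MvPolynomial (Fin (n + 1)) ℝ,
      (∀ x ∈ U, MvPolynomial.eval (Fin.snoc (fun i => x i) (f x)) Q = 0) ∧
      ∃ x ∈ U, MvPolynomial.eval (Fin.snoc (fun i => x i) (f x))
        (MvPolynomial.pderiv (Fin.last n) Q) ≠ 0 := by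
  induction hd : P.totalDegree using Nat.strong_induction_on generalizing P with
  | _ d ih =>
    by_cases hG : ∃ x ∈ U, MvPolynomial.eval (Fin.snoc (fun i => x i) (f x))
        (MvPolynomial.pderiv (Fin.last n) P) ≠ 0
    · exact ⟨P, hPf, hG⟩
    push Not at hG
    by_cases h0 : MvPolynomial.pderiv (Fin.last n) P = 0
    · exfalso
      obtain ⟨x, hx⟩ := hne
      have hev : ∀ᶠ y : Fin n → ℝ in 𝓝 (x : Fin n → ℝ), WithLp.toLp 2 y ∈ U :=
        (PiLp.continuous_toLp 2 _).continuousAt.eventually_mem (hU.mem_nhds hx)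
      obtain ⟨δ, hδ, hball⟩ := Metric.eventually_nhds_iff_ball.1 hev
      apply hP
      apply MvPolynomial.funext_set
        (Fin.snoc (α := fun _ => Set ℝ) (fun i => Metric.ball (x i) δ) univ)
      · intro i
        refine Fin.lastCases ?_ (fun i => ?_) i
        · simpa using infinite_univ
        · rw [Fin.snoc_castSucc, Real.ball_eq_Ioo]
          exact Ioo_infinite (by linarith)
      · intro z hz
        have hzb : (fun i => z (Fin.castSucc i)) ∈ Metric.ball (x : Fin n → ℝ) δ := by
          rw [ball_pi _ hδ]
          intro i _
          simpa using hz (Fin.castSucc i) (mem_univ _)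
        rw [map_zero, ← hPf _ (hball _ hzb)]
        refine MvPolynomial.eval₂Hom_congr' rfl (fun i hi _ => ?_) rfl
        revert hi
        refine Fin.lastCases (fun hi => ?_) (fun i _ => ?_) i
        · exact absurd hi (MvPolynomial.notMem_vars_of_pderiv_eq_zero h0)
        · simp
    · exact ih _ (hd ▸ MvPolynomial.totalDegree_pderiv_lt h0) h0 hG rfl

/-- A nonzero polynomial eventually does not vanish along a sequence of nonzero reals tending to
zero. -/
theorem Filter.Tendsto.eventually_polynomial_eval_ne_zero {c : ℕ → ℝ}
    (hc : Tendsto c atTop (𝓝 0)) (hc0 : ∀ k, c k ≠ 0) {q : Polynomial ℝ} (hq : q ≠ 0) :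
    ∀ᶠ k in atTop, q.eval (c k) ≠ 0 := by
  have h1 : ∀ᶠ t in 𝓝[≠] (0 : ℝ), q.eval t ≠ 0 := by
    have : (q.rootSet ℝ \ {0})ᶜ ∈ 𝓝 (0 : ℝ) :=
      ((q.rootSet_finite ℝ).subset sdiff_subset).isClosed.isOpen_compl.mem_nhds (by simp)
    filter_upwards [nhdsWithin_le_nhds this, self_mem_nhdsWithin] with t ht ht0 h
    exact ht ⟨by simpa [Polynomial.mem_rootSet, hq] using h, ht0⟩
  exact (tendsto_nhdsWithin_iff.2 ⟨hc, .of_forall hc0⟩).eventually h1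

/-- Iterated directional derivatives as iterated derivatives along a line. -/
theorem iteratedDeriv_comp_line {E : Type*} [NormedAddCommGroup E] [NormedSpace ℝ E] {U : Set E}
    (hU : IsOpen U) {g : E → ℝ} (hg : AnalyticOnNhd ℝ g U) (x w : E) (m : ℕ) :
    ∀ t : ℝ, x + t • w ∈ U →
      iteratedDeriv m (fun t : ℝ => g (x + t • w)) t = (dirDeriv w)^[m] g (x + t • w) := by
  have hline : ∀ t : ℝ, HasDerivAt (fun t : ℝ => x + t • w) w t := fun t => by
    simpa using ((hasDerivAt_id t).smul_const w).const_add x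
  induction m with
  | zero => intro t _; simp
  | succ m ih =>
    intro t ht
    have hnear : ∀ᶠ s in 𝓝 t, x + s • w ∈ U :=
      (hline t).continuousAt.eventually_mem (hU.mem_nhds ht)
    have heq : iteratedDeriv m (fun t : ℝ => g (x + t • w)) =ᶠ[𝓝 t]
        fun s => (dirDeriv w)^[m] g (x + s • w) := hnear.mono fun s hs => ih s hs
    rw [iteratedDeriv_succ, heq.deriv_eq, Function.iterate_succ_apply']
    exact ((hg.iterate_dirDeriv w m _ ht).differentiableAt.hasFDerivAt.comp_hasDerivAt t
      (hline t)).deriv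

/-- A nonzero analytic function on a connected open set has, at every point, a nonzero iterated
directional derivative. -/
theorem AnalyticOnNhd.exists_iterate_dirDeriv_ne_zero {E : Type*} [NormedAddCommGroup E]
    [NormedSpace ℝ E] {U : Set E} (hU : IsOpen U) (hUc : IsPreconnected U) {g : E → ℝ}
    (hg : AnalyticOnNhd ℝ g U) (hne : ∃ y ∈ U, g y ≠ 0) {x : E} (hx : x ∈ U) :
    ∃ w m, (_root_.dirDeriv w)^[m] g x ≠ 0 := by
  obtain ⟨y, hy, hgy⟩ := hne
  obtain ⟨δ, hδ, hball⟩ := Metric.isOpen_iff.1 hU x hx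
  obtain ⟨z, hz, hgz⟩ : ∃ z ∈ Metric.ball x δ, g z ≠ 0 := by
    by_contra! h
    exact hgy (hg.eqOn_zero_of_preconnected_of_eventuallyEq_zero hUc hx
      (eventually_of_mem (Metric.ball_mem_nhds x hδ) h) hy)
  refine ⟨z - x, ?_⟩
  by_contra! h
  let γ : ℝ → E := fun t => x + t • (z - x)
  have hγ : ∀ t ∈ Icc (0 : ℝ) 1, γ t ∈ U := fun t ht => hball
    ((convex_ball x δ).add_smul_sub_mem (Metric.mem_ball_self hδ) hz ht)
  have hφ : AnalyticOnNhd ℝ (g ∘ γ) (Icc 0 1) := fun t ht =>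
    (hg _ (hγ t ht)).comp (by fun_prop)
  have h0 : (0 : ℝ) ∈ Icc (0 : ℝ) 1 := by simp
  have hzero : ∀ᶠ t in 𝓝 (0 : ℝ), (g ∘ γ) t = 0 := by
    rw [← analyticOrderAt_eq_top, ENat.eq_top_iff_forall_ge]
    intro m
    rw [natCast_le_analyticOrderAt_iff_iteratedDeriv_eq_zero (hφ 0 h0)]
    intro i _
    have := iteratedDeriv_comp_line hU hg x (z - x) i 0 (by simpa using hx)
    rw [zero_smul, add_zero, h i] at this
    exact this
  have := hφ.eqOn_zero_of_preconnected_of_eventuallyEq_zero isPreconnected_Icc h0 hzero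
    (show (1 : ℝ) ∈ Icc (0 : ℝ) 1 by simp)
  exact hgz (by simpa [γ] using this)

theorem AnalyticOnNhd.snoc_coord {n : ℕ} {U : Set (EuclideanSpace ℝ (Fin n))}
    {f : EuclideanSpace ℝ (Fin n) → ℝ} (hf : AnalyticOnNhd ℝ f U) (s : Fin (n + 1)) :
    AnalyticOnNhd ℝ (fun x => Fin.snoc (α := fun _ => ℝ) (fun i => x i) (f x) s) U := by
  refine Fin.lastCases ?_ (fun i => ?_) s
  · simpa using hf
  · simpa using (EuclideanSpace.proj (𝕜 := ℝ) i).analyticOnNhd U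

theorem AnalyticOnNhd.eval_snoc {n : ℕ} {U : Set (EuclideanSpace ℝ (Fin n))}
    {f : EuclideanSpace ℝ (Fin n) → ℝ} (hf : AnalyticOnNhd ℝ f U)
    (Q : MvPolynomial (Fin (n + 1)) ℝ) :
    AnalyticOnNhd ℝ (fun x => MvPolynomial.eval (Fin.snoc (fun i => x i) (f x)) Q) U :=
  AnalyticOnNhd.aeval_mvPolynomial hf.snoc_coord Q

/-- The chain rule for a derivation at a generalized point, for algebraic analytic functions. -/
theorem derivation_eq_sum_of_algebraic {n : ℕ} {K : Type*} [Field K] [Algebra ℝ K]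
    (D : Derivation ℝ K K) {U : Set (EuclideanSpace ℝ (Fin n))} (hU : IsOpen U)
    {ev : (EuclideanSpace ℝ (Fin n) → ℝ) →ₐ[ℝ] K} (hev : ∀ g h, EqOn g h U → ev g = ev h)
    {f : EuclideanSpace ℝ (Fin n) → ℝ} (hf : AnalyticOnNhd ℝ f U)
    {Q : MvPolynomial (Fin (n + 1)) ℝ}
    (hQ : ∀ x ∈ U, MvPolynomial.eval (Fin.snoc (fun i => x i) (f x)) Q = 0)
    {w : EuclideanSpace ℝ (Fin n)}
    (hw : taylorSeries ev w (fun x => MvPolynomial.eval (Fin.snoc (fun i => x i) (f x))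
      (MvPolynomial.pderiv (Fin.last n) Q)) ≠ 0) :
    D (ev f) = ∑ i, D (ev fun x => x i) * ev (dirDeriv (EuclideanSpace.single i 1) f) := by
  let v : Fin n → K := fun i => D (ev fun x => x i)
  let e : Fin n → EuclideanSpace ℝ (Fin n) := fun i => EuclideanSpace.single i 1
  let g : EuclideanSpace ℝ (Fin n) → Fin (n + 1) → ℝ :=
    fun x => Fin.snoc (α := fun _ => ℝ) (fun i => x i) (f x)
  have hg : ∀ s, AnalyticOnNhd ℝ (g · s) U := hf.snoc_coord
  have hcoord : ∀ i : Fin n, chainDefect ev w D v e (fun x => x i) = 0 := fun i => by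
    refine chainDefect_clm (EuclideanSpace.proj (𝕜 := ℝ) i) ?_
    have : ∀ j, (EuclideanSpace.proj (𝕜 := ℝ) i) (e j) = if j = i then 1 else 0 := fun j => by
      simp [e, eq_comm]
    simp only [this, ite_smul, one_smul, zero_smul, Finset.sum_ite_eq', Finset.mem_univ, if_true]
    rfl
  have key := chainDefect_mvPolynomial (ev := ev) (D := D) (v := v) (e := e) (w := w) hU hev hg Q
  have hzero : chainDefect ev w D v e (fun y => MvPolynomial.aeval (g y) Q) = 0 := by
    have hQ0 : EqOn (fun y => MvPolynomial.aeval (g y) Q) (fun _ => 0) U := fun y hy => hQ y hy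
    rw [chainDefect_congr hU hev hQ0, chainDefect_const]
  rw [hzero, Fin.sum_univ_castSucc] at key
  simp only [g, Fin.snoc_castSucc, Fin.snoc_last, hcoord, mul_zero, Finset.sum_const_zero,
    zero_add] at key
  have hf0 := (mul_eq_zero.1 key.symm).resolve_left hw
  have := congrArg PowerSeries.constantCoeff hf0
  rwa [constantCoeff_chainDefect, map_zero, sub_eq_zero] at this

noncomputable instance : Algebra ℝ Hyperreal := Hyperreal.coeRingHom.toRingHom.toAlgebra

/-- Evaluation of functions at a sequence of points, with hyperreal values. -/
noncomputable def evalSeq {E : Type*} (x : ℕ → E) : (E → ℝ) →ₐ[ℝ] Hyperreal where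
  toFun g := Hyperreal.ofSeq fun k => g (x k)
  map_one' := rfl
  map_mul' _ _ := rfl
  map_zero' := rfl
  map_add' _ _ := rfl
  commutes' _ := rfl

theorem evalSeq_ne_zero {E : Type*} {x : ℕ → E} {g : E → ℝ}
    (h : ∀ᶠ k in atTop, g (x k) ≠ 0) : evalSeq x g ≠ 0 := by
  intro h0
  have h1 : ∀ᶠ k in (hyperfilter ℕ : Filter ℕ), g (x k) = 0 := Filter.Germ.coe_eq.1 h0
  have h2 : ∀ᶠ k in (hyperfilter ℕ : Filter ℕ), g (x k) ≠ 0 :=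
    Nat.hyperfilter_le_atTop h
  obtain ⟨k, hk1, hk2⟩ := (h1.and h2).exists
  exact hk2 hk1

/-- The values along a sequence, if nonzero and tending to zero, form a transcendental hyperreal
number. -/
theorem transcendental_evalSeq {E : Type*} {x : ℕ → E} {g : E → ℝ}
    (h : Tendsto (fun k => g (x k)) atTop (𝓝 0)) (h0 : ∀ k, g (x k) ≠ 0) :
    Transcendental ℝ (evalSeq x g) := by
  rw [transcendental_iff]
  intro q hq
  by_contra hq0
  rw [Polynomial.aeval_algHom_apply] at hq
  refine evalSeq_ne_zero ?_ hq
  filter_upwards [h.eventually_polynomial_eval_ne_zero h0 hq0] with k hk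
  simpa [Polynomial.aeval_fn_apply] using hk

theorem stmt_13 (n : ℕ) (r : ℝ) (hr : 0 < r)
    (Ω : Set (EuclideanSpace ℝ (Fin n))) (hΩ : Ω = {x | ‖x‖ ≤ r})
    (U : Set (EuclideanSpace ℝ (Fin n))) (hUopen : IsOpen U) (hUconn : IsConnected U)
    (hΩU : Ω ⊆ U)
    (f : EuclideanSpace ℝ (Fin n) → ℝ) (hf : AnalyticOnNhd ℝ f U)
    (hfne : ∃ x ∈ U, f x ≠ 0)
    (P : MvPolynomial (Fin (n + 1)) ℝ) (hP : P ≠ 0)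
    (hPf : ∀ x ∈ U, MvPolynomial.eval (Fin.snoc (fun i => x i) (f x)) P = 0) :
    ∃ ε > 0, ∀ x : EuclideanSpace ℝ (Fin n), ‖x‖ = r → 0 < |f x| → |f x| < ε →
      ∀ c₁ c₂ : ℝ, c₁ • x + c₂ • gradient f x = 0 → c₁ = 0 ∧ c₂ = 0 := by
  by_contra! hcon
  have hex : ∀ k : ℕ, ∃ x : EuclideanSpace ℝ (Fin n), ‖x‖ = r ∧ 0 < |f x| ∧
      |f x| < 1 / ((k : ℝ) + 1) ∧ ∃ l : ℝ, gradient f x = l • x := fun k => by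
    obtain ⟨x, hxr, hx0, hxk, c₁, c₂, hc, hne⟩ := hcon (1 / ((k : ℝ) + 1)) (by positivity)
    refine ⟨x, hxr, hx0, hxk, -(c₁ / c₂), ?_⟩
    have hc₂ : c₂ ≠ 0 := by
      rintro rfl
      rw [zero_smul, add_zero, smul_eq_zero] at hc
      exact hne (hc.resolve_right (norm_pos_iff.1 (hxr ▸ hr))) rfl
    have : c₂ • gradient f x = -(c₁ • x) := eq_neg_of_add_eq_zero_right hc
    rw [← inv_smul_smul₀ hc₂ (gradient f x), this, smul_neg, smul_smul, neg_smul, div_eq_inv_mul]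
  choose y hyr hy0 hyk l hl using hex
  obtain ⟨x₀, hx₀, φ, hφ, hlim⟩ := (isCompact_sphere (0 : EuclideanSpace ℝ (Fin n)) r).tendsto_subseq
    (x := y) fun k => by simpa using hyr k
  let x : ℕ → EuclideanSpace ℝ (Fin n) := y ∘ φ
  have hxU : ∀ k, x k ∈ U := fun k => hΩU (hΩ ▸ (hyr _).le)
  have hx₀U : x₀ ∈ U := hΩU (hΩ ▸ (mem_sphere_zero_iff_norm.1 hx₀).le)
  have hlim0 : Tendsto (fun k => f (x k)) atTop (𝓝 0) := by
    rw [tendsto_zero_iff_abs_tendsto_zero]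
    exact (squeeze_zero (fun k => abs_nonneg (f (y k))) (fun k => (hyk k).le)
      tendsto_one_div_add_atTop_nhds_zero_nat).comp hφ.tendsto_atTop
  obtain ⟨D, hD⟩ := (transcendental_evalSeq hlim0
    fun k => abs_pos.1 (hy0 _)).exists_derivation_eq_one
  have hev : ∀ g h, EqOn g h U → evalSeq x g = evalSeq x h := fun g h hgh =>
    congrArg Hyperreal.ofSeq (funext fun k => hgh (hxU k))
  obtain ⟨Q, hQ, hQne⟩ := exists_annihilator_pderiv_ne_zero hUopen hUconn.nonempty hP hPf
  have hG := hf.eval_snoc (MvPolynomial.pderiv (Fin.last n) Q)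
  obtain ⟨w, m, hwm⟩ := hG.exists_iterate_dirDeriv_ne_zero hUopen hUconn.isPreconnected hQne hx₀U
  have hT : taylorSeries (evalSeq x) w (fun x => MvPolynomial.eval
      (Fin.snoc (fun i => x i) (f x)) (MvPolynomial.pderiv (Fin.last n) Q)) ≠ 0 := by
    intro h0
    have hm := congrArg (PowerSeries.coeff m) h0
    rw [taylorSeries, PowerSeries.coeff_mk, map_zero, smul_eq_zero] at hm
    refine evalSeq_ne_zero ?_ (hm.resolve_left (by positivity))
    exact ((hG.iterate_dirDeriv w m x₀ hx₀U).continuousAt.tendsto.comp hlim).eventually_ne hwm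
  have hchain := derivation_eq_sum_of_algebraic D hUopen hev hf hQ hT
  let L : Hyperreal := Hyperreal.ofSeq fun k => l (φ k)
  have hgrad : ∀ i, evalSeq x (dirDeriv (EuclideanSpace.single i 1) f) =
      L * evalSeq x (fun x => x i) := fun i => by
    refine congrArg Hyperreal.ofSeq (a₂ := fun k => l (φ k) * x k i) (funext fun k => ?_)
    change fderiv ℝ f (y (φ k)) (EuclideanSpace.single i 1) = l (φ k) * y (φ k) i
    rw [← inner_gradient_left, hl, EuclideanSpace.inner_single_right]
    simp
  have hsq : ∑ i, evalSeq x (fun x => x i) * evalSeq x (fun x => x i) =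
      algebraMap ℝ Hyperreal (r ^ 2) := by
    simp only [← map_mul, ← map_sum]
    refine congrArg Hyperreal.ofSeq (a₂ := fun _ => r ^ 2) (funext fun k => ?_)
    have := EuclideanSpace.real_norm_sq_eq (x k)
    rw [show ‖x k‖ = r from hyr _] at this
    rw [this]
    simp [Finset.sum_apply, sq]
  have hDsq := congrArg D hsq
  simp only [map_sum, Derivation.leibniz, Derivation.map_algebraMap, smul_eq_mul, ← two_mul,
    ← Finset.mul_sum] at hDsq
  have hzero := (mul_eq_zero.1 hDsq).resolve_left two_ne_zero
  rw [hD] at hchain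
  apply one_ne_zero (α := Hyperreal)
  rw [hchain, ← mul_zero L, ← hzero, Finset.mul_sum]
  exact Finset.sum_congr rfl fun i _ => by rw [hgrad]; ring
end

section
/- Let U ⊆ ℝⁿ be an open neighbourhood of 0 and let f : U → ℝ be real-analytic with f(0) = 0. Let φ : (−1, 1) → ℝⁿ be a real-analytic curve with φ([0,1)) ⊆ U, f(φ(0)) = 0 and f(φ(t)) ≠ 0 for all t ∈ (0,1). Suppose ϱ₀ ∈ [0,1) and there are constants C, C₁ > 0 such that C·|f(φ(t))|^{ϱ₀} ≤ |∇f(φ(t))| ≤ C₁·|f(φ(t))|^{ϱ₀} for all t ∈ [0,1). If Q ∈ ℂ[y, u] is a nonzero polynomial of total degree D such that Q(f(φ(t)), |∇f(φ(t))|²) = 0 for all t ∈ [0,1), then ϱ₀ ≤ 1 − 1/D if D is even, and ϱ₀ ≤ 1 − 1/(D+1) if D is odd. -/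
open Filter Topology Asymptotics

/-- A finite sum of terms comparable to pairwise distinct real powers of a quantity tending to `0`
from the right cannot vanish identically near the limit. -/
theorem not_eventually_sum_eq_zero_of_isTheta_rpow {α σ : Type*} {l : Filter α} [l.NeBot]
    {s : α → ℝ} (hs : Tendsto s l (𝓝[>] 0)) {S : Finset σ} (hS : S.Nonempty) {e : σ → ℝ}
    (he : Set.InjOn e S) {T : σ → α → ℂ} (hT : ∀ i ∈ S, T i =Θ[l] fun t => s t ^ e i) :
    ¬ ∀ᶠ t in l, ∑ i ∈ S, T i t = 0 := by
  classical
  intro hzero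
  have hpos : ∀ᶠ t in l, 0 < s t := hs.eventually self_mem_nhdsWithin
  obtain ⟨i₀, hi₀, hmin⟩ := S.exists_min_image e hS
  have hlittle : ∀ i ∈ S.erase i₀, T i =o[l] T i₀ := by
    intro i hi
    obtain ⟨hne, hi⟩ := Finset.mem_erase.1 hi
    have hlt : e i₀ < e i := lt_of_le_of_ne (hmin i hi) fun h => hne (he hi hi₀ h.symm)
    refine ((hT i hi).isBigO.trans_isLittleO ?_).trans_isBigO (hT i₀ hi₀).symm.isBigO
    refine (isLittleO_iff_tendsto' ?_).2 ?_
    · filter_upwards [hpos] with t ht h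
      exact absurd h (Real.rpow_pos_of_pos ht _).ne'
    · have h0 : Tendsto (fun t => s t ^ (e i - e i₀)) l (𝓝 0) := by
        have hc := (Real.continuousAt_rpow_const 0 (e i - e i₀) (Or.inr (sub_pos.2 hlt).le)).tendsto
        rw [Real.zero_rpow (sub_pos.2 hlt).ne'] at hc
        exact hc.comp (hs.mono_right nhdsWithin_le_nhds)
      refine h0.congr' ?_
      filter_upwards [hpos] with t ht
      exact Real.rpow_sub ht _ _
  have hsum : (fun t => ∑ i ∈ S.erase i₀, T i t) =o[l] T i₀ := IsLittleO.fun_sum hlittle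
  have hself : T i₀ =o[l] T i₀ := by
    refine hsum.neg_left.congr' ?_ EventuallyEq.rfl
    filter_upwards [hzero] with t ht
    rw [← Finset.add_sum_erase S (fun i => T i t) hi₀] at ht
    linear_combination -ht
  have hT0 : ∀ᶠ t in l, T i₀ t = 0 := by
    filter_upwards [hself.def one_half_pos] with t ht
    exact norm_le_zero_iff.1 (by linarith)
  obtain ⟨t, ht, h, hp⟩ := (hT0.and ((hT i₀ hi₀).eq_zero_iff.and hpos)).exists
  exact (Real.rpow_pos_of_pos hp _).ne' (h.1 ht)

/-- If a polynomial relation holds between `F → 0` and `G ^ 2`, where `G` is comparable to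
`|F| ^ ρ`, then two distinct monomials of the polynomial have equal weight for the
weights `(1, 2 * ρ)`. -/
theorem exists_ne_weight_eq_of_eval_eq_zero {α : Type*} {l : Filter α} [l.NeBot]
    {F G : α → ℝ} {ρ : ℝ} (hF : Tendsto F l (𝓝[≠] 0)) (hG : G =Θ[l] fun t => |F t| ^ ρ)
    {Q : MvPolynomial (Fin 2) ℂ} (hQ : Q ≠ 0)
    (hvan : ∀ᶠ t in l, MvPolynomial.eval ![(F t : ℂ), ((G t ^ 2 : ℝ) : ℂ)] Q = 0) :
    ∃ m ∈ Q.support, ∃ m' ∈ Q.support, m ≠ m' ∧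
      (m 0 : ℝ) + 2 * ρ * m 1 = m' 0 + 2 * ρ * m' 1 := by
  by_contra! hcon
  have hs : Tendsto (fun t => |F t|) l (𝓝[>] 0) := tendsto_abs_nhdsNE_zero.comp hF
  refine not_eventually_sum_eq_zero_of_isTheta_rpow hs (S := Q.support)
    (e := fun m => (m 0 : ℝ) + 2 * ρ * m 1)
    (T := fun m t => Q.coeff m * ((F t : ℂ) ^ m 0 * ((G t ^ 2 : ℝ) : ℂ) ^ m 1))
    (MvPolynomial.support_nonempty.2 hQ) ?_ ?_ ?_
  · intro m hm m' hm' h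
    by_contra hne
    exact hcon m hm m' hm' hne h
  · intro m hm
    have hF' : (fun t => (F t : ℂ)) =Θ[l] fun t => |F t| :=
      IsTheta.of_norm_eventuallyEq (Eventually.of_forall fun t => by simp)
    have hG' : (fun t => ((G t ^ 2 : ℝ) : ℂ)) =Θ[l] fun t => (|F t| ^ ρ) ^ 2 :=
      (IsTheta.of_norm_eventuallyEq (g := fun t => G t ^ 2)
        (Eventually.of_forall fun t => by simp)).trans (hG.pow 2)
    refine ((isTheta_const_mul_left (MvPolynomial.mem_support_iff.1 hm)).2
      ((hF'.pow (m 0)).mul (hG'.pow (m 1)))).trans_eventuallyEq ?_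
    filter_upwards [hs.eventually self_mem_nhdsWithin] with t ht
    have ht : 0 < |F t| := ht
    rw [Real.rpow_add ht, Real.rpow_natCast, mul_comm 2 ρ, Real.rpow_mul_natCast ht.le,
      Real.rpow_mul ht.le, Real.rpow_two]
  · filter_upwards [hvan] with t ht
    rw [MvPolynomial.eval_eq'] at ht
    simpa using ht

theorem le_one_sub_one_div_of_natCast_eq {ρ : ℝ} (hρ : ρ < 1) {a b k : ℕ} (hb : 0 < b)
    (hk : 0 < k) (ha : a ≤ 2 * k) (h : (a : ℝ) = 2 * ρ * b) : ρ ≤ 1 - 1 / ((2 * k : ℕ) : ℝ) := by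
  have hb' : (0 : ℝ) < b := by exact_mod_cast hb
  have hk' : (1 : ℝ) ≤ k := by exact_mod_cast hk
  have ha' : (a : ℝ) ≤ 2 * k := by exact_mod_cast ha
  have hab : a + 1 ≤ 2 * b := by
    have : (a : ℝ) < 2 * b := by nlinarith
    exact_mod_cast this
  have hab' : (a : ℝ) + 1 ≤ 2 * b := by exact_mod_cast hab
  have h2k : (0 : ℝ) < 2 * k := by linarith
  push_cast
  rw [le_sub_iff_add_le, ← le_sub_iff_add_le', div_le_iff₀ h2k]
  rcases le_or_gt b k with hbk | hbk
  · have : (b : ℝ) ≤ k := by exact_mod_cast hbk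
    nlinarith [mul_nonneg (sub_nonneg.2 hρ.le) (sub_nonneg.2 this)]
  · have hbk' : (k : ℝ) + 1 ≤ b := by exact_mod_cast hbk
    have hρ0 : 0 ≤ ρ := by
      by_contra! hneg
      have := a.cast_nonneg (α := ℝ)
      nlinarith
    have h1 : ρ * (k + 1) ≤ k := by nlinarith [mul_le_mul_of_nonneg_left hbk' hρ0]
    by_contra! hlt
    nlinarith

theorem le_one_sub_one_div_of_weight_eq {ρ : ℝ} (hρ0 : 0 ≤ ρ) (hρ : ρ < 1) {D : ℕ}
    {m m' : Fin 2 →₀ ℕ} (hm : m.sum (fun _ e => e) ≤ D) (hm' : m'.sum (fun _ e => e) ≤ D)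
    (hne : m ≠ m') (h : (m 0 : ℝ) + 2 * ρ * m 1 = m' 0 + 2 * ρ * m' 1) :
    (Even D → ρ ≤ 1 - 1 / (D : ℝ)) ∧ (Odd D → ρ ≤ 1 - 1 / ((D : ℝ) + 1)) := by
  wlog hlt : m 1 < m' 1 generalizing m m'
  · rcases (not_lt.1 hlt).lt_or_eq with hlt | heq
    · exact this hm' hm hne.symm h.symm hlt
    · refine absurd (Finsupp.ext fun i => ?_) hne
      rw [heq] at h
      have h0 : m 0 = m' 0 := by exact_mod_cast add_right_cancel h
      fin_cases i
      exacts [h0, heq.symm]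
  rw [Finsupp.sum_fintype _ _ (fun _ => rfl), Fin.sum_univ_two] at hm hm'
  have hlt' : (m 1 : ℝ) < m' 1 := by exact_mod_cast hlt
  have hle : m' 0 ≤ m 0 := by
    have : (m' 0 : ℝ) ≤ m 0 := by nlinarith [mul_nonneg hρ0 (sub_pos.2 hlt').le]
    exact_mod_cast this
  have hab : ((m 0 - m' 0 : ℕ) : ℝ) = 2 * ρ * (m' 1 - m 1 : ℕ) := by
    rw [Nat.cast_sub hle, Nat.cast_sub hlt.le]
    linear_combination h
  constructor
  · rintro ⟨k, rfl⟩
    rw [← two_mul]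
    exact le_one_sub_one_div_of_natCast_eq hρ (by lia) (by lia) (by lia) hab
  · rintro ⟨k, rfl⟩
    have := le_one_sub_one_div_of_natCast_eq (k := k + 1) hρ (by lia) (by lia) (by lia) hab
    convert this using 3
    push_cast
    ring

theorem stmt_14 (n : ℕ) (U : Set (EuclideanSpace ℝ (Fin n))) (hUopen : IsOpen U)
    (h0U : (0 : EuclideanSpace ℝ (Fin n)) ∈ U)
    (f : EuclideanSpace ℝ (Fin n) → ℝ) (hf : AnalyticOnNhd ℝ f U)
    (hf0 : f 0 = 0)
    (φ : ℝ → EuclideanSpace ℝ (Fin n))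
    (hφ : AnalyticOnNhd ℝ φ (Set.Ioo (-1 : ℝ) 1))
    (hφU : ∀ t ∈ Set.Ico (0 : ℝ) 1, φ t ∈ U)
    (hφ0 : f (φ 0) = 0) (hφne : ∀ t ∈ Set.Ioo (0 : ℝ) 1, f (φ t) ≠ 0)
    (ϱ₀ : ℝ) (hϱ₀ : ϱ₀ ∈ Set.Ico (0 : ℝ) 1) (C C₁ : ℝ) (hC : 0 < C) (hC₁ : 0 < C₁)
    (hLoj : ∀ t ∈ Set.Ico (0 : ℝ) 1,
      C * |f (φ t)| ^ ϱ₀ ≤ ‖gradient f (φ t)‖ ∧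
      ‖gradient f (φ t)‖ ≤ C₁ * |f (φ t)| ^ ϱ₀)
    (Q : MvPolynomial (Fin 2) ℂ) (hQ : Q ≠ 0) (D : ℕ) (hD : D = Q.totalDegree)
    (hQvan : ∀ t ∈ Set.Ico (0 : ℝ) 1,
      MvPolynomial.eval ![((f (φ t) : ℝ) : ℂ), ((‖gradient f (φ t)‖ ^ 2 : ℝ) : ℂ)] Q = 0) :
    (Even D → ϱ₀ ≤ 1 - 1 / (D : ℝ)) ∧ (Odd D → ϱ₀ ≤ 1 - 1 / ((D : ℝ) + 1)) := by
  have hmem : ∀ᶠ t in 𝓝[>] (0 : ℝ), t ∈ Set.Ioo (0 : ℝ) 1 := Ioo_mem_nhdsGT one_pos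
  have hcont : ContinuousAt (fun t => f (φ t)) 0 :=
    ContinuousAt.comp (hf _ (hφU 0 (by simp))).continuousAt (hφ 0 (by simp)).continuousAt
  have hF : Tendsto (fun t => f (φ t)) (𝓝[>] 0) (𝓝[≠] 0) := by
    refine tendsto_nhdsWithin_iff.2 ⟨?_, hmem.mono hφne⟩
    have := hcont.tendsto
    rw [hφ0] at this
    exact this.mono_left nhdsWithin_le_nhds
  have hG : (fun t => ‖gradient f (φ t)‖) =Θ[𝓝[>] 0] fun t => |f (φ t)| ^ ϱ₀ := by
    constructor
    · refine IsBigO.of_bound C₁ (hmem.mono fun t ht => ?_)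
      rw [norm_norm, Real.norm_of_nonneg (by positivity)]
      exact (hLoj t ⟨ht.1.le, ht.2⟩).2
    · refine IsBigO.of_bound C⁻¹ (hmem.mono fun t ht => ?_)
      rw [norm_norm, Real.norm_of_nonneg (by positivity), ← div_eq_inv_mul, le_div_iff₀' hC]
      exact (hLoj t ⟨ht.1.le, ht.2⟩).1
  obtain ⟨m, hm, m', hm', hne, h⟩ := exists_ne_weight_eq_of_eval_eq_zero hF hG hQ
    (hmem.mono fun t ht => hQvan t ⟨ht.1.le, ht.2⟩)
  subst hD
  exact le_one_sub_one_div_of_weight_eq hϱ₀.1 hϱ₀.2 (MvPolynomial.le_totalDegree hm)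
    (MvPolynomial.le_totalDegree hm') hne h
end
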